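/- arXiv:0806.4048 — 2 statements merged into one kernel-verified Lean document; each statement's English description precedes it below -/
import Mathlib

section
/- Let 𝔽 be ℝ or ℂ and let n, m, p be positive integers with n ≤ m and p even. Then max.rank_𝔽(n,m,p) ≤ 2n + m(p−2)/2. -/
/-- The rank of a 3-tensor, presented as a family of matrices (its slices):
the least `r` such that each slice `A k` is `∑ i, (c i k) • (a i) (b i)ᵀ`
for some vectors `a i`, `b i`, `c i`. -/
noncomputable def tensorRank (𝔽 : Type*) [Field 𝔽] {α β γ : Type*}
    [Fintype α] [Fintype β] [Fintype γ] (A : γ → Matrix α β 𝔽) : ℕ :=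
  sInf {r : ℕ | ∃ (a : Fin r → α → 𝔽) (b : Fin r → β → 𝔽) (c : Fin r → γ → 𝔽),
    ∀ k, A k = ∑ i, c i k • Matrix.vecMulVec (a i) (b i)}

/-- `maxRank 𝔽 m n p` is the maximal rank of an `m × n × p` tensor over `𝔽`. -/
noncomputable def maxRank (𝔽 : Type*) [Field 𝔽] (m n p : ℕ) : ℕ :=
  sSup {r : ℕ | ∃ A : Fin p → Matrix (Fin m) (Fin n) 𝔽, tensorRank 𝔽 A = r}

open Filter Topology

namespace Matrix

variable {𝔽 : Type*}

theorem mul_diagonal_mul_eq_sum {α β κ : Type*} [CommSemiring 𝔽] [Fintype κ] [DecidableEq κ]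
    (L : Matrix α κ 𝔽) (u : κ → 𝔽) (R : Matrix κ β 𝔽) :
    L * diagonal u * R = ∑ i, u i • vecMulVec (L.col i) (R.row i) := by
  ext a b
  rw [mul_apply]
  simp only [mul_diagonal, sum_apply, smul_apply, vecMulVec_apply, col_apply,
    row_apply, smul_eq_mul]
  exact Finset.sum_congr rfl fun i _ => by ring

theorem contDiff_det {E κ : Type*} [NontriviallyNormedField 𝔽] [NormedAddCommGroup E]
    [NormedSpace 𝔽 E] [Fintype κ] [DecidableEq κ] {k : WithTop ℕ∞} {M : E → Matrix κ κ 𝔽}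
    (hM : ∀ i j, ContDiff 𝔽 k fun x => M x i j) : ContDiff 𝔽 k fun x => (M x).det := by
  simp only [det_apply']
  exact ContDiff.sum fun σ _ => contDiff_const.mul (contDiff_prod fun i _ => hM _ _)

/-- The determinant of `diagonal l - t • 1` has a simple zero at every `l i`. -/
theorem exists_hasDerivAt_det_diagonal_sub_smul {κ : Type*} [NontriviallyNormedField 𝔽]
    [Fintype κ] [DecidableEq κ] {l : κ → 𝔽} (hl : Function.Injective l) (i : κ) :
    ∃ c ≠ 0, HasDerivAt (fun t : 𝔽 => (diagonal l - t • (1 : Matrix κ κ 𝔽)).det) c (l i) := by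
  have hdet : (fun t : 𝔽 => (diagonal l - t • (1 : Matrix κ κ 𝔽)).det) =
      fun t => (l i - t) * ∏ j ∈ Finset.univ.erase i, (l j - t) := by
    ext t
    rw [smul_one_eq_diagonal, diagonal_sub, det_diagonal,
      Finset.mul_prod_erase _ (fun j => l j - t) (Finset.mem_univ i)]
  have hdiff : DifferentiableAt 𝔽 (fun t => ∏ j ∈ Finset.univ.erase i, (l j - t)) (l i) := by
    fun_prop
  have hmul := ((hasDerivAt_id (l i)).const_sub (l i)).mul hdiff.hasDerivAt
  refine ⟨-∏ j ∈ Finset.univ.erase i, (l j - l i), ?_, ?_⟩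
  · refine neg_ne_zero.2 (Finset.prod_ne_zero_iff.2 fun j hj => sub_ne_zero.2 fun h => ?_)
    exact Finset.ne_of_mem_erase hj (hl h)
  · rw [hdet]
    simpa [Pi.mul_def] using hmul

/-- The eigenvalues of a small perturbation of the pencil `(1, diagonal l)` depend continuously
on the perturbation. -/
theorem exists_tendsto_det_pencil_eq_zero {κ : Type*} [RCLike 𝔽] [Fintype κ] [DecidableEq κ]
    (N₁ N₂ : Matrix κ κ 𝔽) {l : κ → 𝔽} (hl : Function.Injective l) (i : κ) :
    ∃ ψ : 𝔽 → 𝔽, Tendsto ψ (𝓝 0) (𝓝 (l i)) ∧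
      ∀ᶠ s in 𝓝 (0 : 𝔽), (diagonal l + s • N₂ - ψ s • (1 + s • N₁)).det = 0 := by
  let f : 𝔽 × 𝔽 → 𝔽 := fun v => (diagonal l + v.1 • N₂ - v.2 • (1 + v.1 • N₁)).det
  have hf : ContDiff 𝔽 1 f := contDiff_det fun a b => by
    simp only [sub_apply, add_apply, smul_apply, smul_eq_mul]
    fun_prop
  have hfu : HasStrictFDerivAt f (fderiv 𝔽 f (0, l i)) (0, l i) :=
    hf.contDiffAt.hasStrictFDerivAt one_ne_zero
  obtain ⟨c, hc, hder⟩ := exists_hasDerivAt_det_diagonal_sub_smul hl i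
  have hcomp : HasDerivAt (fun t : 𝔽 => f (0, t)) (fderiv 𝔽 f (0, l i) (0, 1)) (l i) :=
    hfu.hasFDerivAt.comp_hasDerivAt (l i) ((hasDerivAt_const _ _).prodMk (hasDerivAt_id _))
  have hval : fderiv 𝔽 f (0, l i) (0, 1) = c :=
    hcomp.unique (by simpa [f] using hder)
  have hinv : (fderiv 𝔽 f (0, l i) ∘L .inr 𝔽 𝔽 𝔽).IsInvertible :=
    ⟨ContinuousLinearEquiv.unitsEquivAut 𝔽 (Units.mk0 c hc), by ext; simp [hval]⟩
  refine ⟨hfu.implicitFunctionOfProdDomain hinv, hfu.tendsto_implicitFunctionOfProdDomain hinv, ?_⟩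
  have hzero : f (0, l i) = 0 := by
    have : diagonal l - l i • (1 : Matrix κ κ 𝔽) = diagonal fun j => l j - l i := by
      rw [smul_one_eq_diagonal, diagonal_sub]
    simp only [f, zero_smul, add_zero, this, det_diagonal]
    exact Finset.prod_eq_zero (Finset.mem_univ i) (sub_self _)
  filter_upwards [hfu.eventually_apply_implicitFunctionOfProdDomain hinv] with s hs
  exact hs.trans hzero

/-- A pencil with pairwise distinct eigenvalues is simultaneously diagonalizable. -/
theorem exists_eq_mul_diagonal_mul_of_det_eq_zero {κ : Type*} [Field 𝔽] [Fintype κ]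
    [DecidableEq κ] {M₁ M₂ : Matrix κ κ 𝔽} (hM₁ : IsUnit M₁.det) {μ : κ → 𝔽}
    (hμ : Function.Injective μ) (hdet : ∀ i, (M₂ - μ i • M₁).det = 0) :
    ∃ R S : Matrix κ κ 𝔽, M₁ = R * S ∧ M₂ = R * diagonal μ * S := by
  choose v hv hker using fun i => exists_mulVec_eq_zero_iff.2 (hdet i)
  have heig (i) : M₂ *ᵥ v i = μ i • M₁ *ᵥ v i := by
    simpa [sub_mulVec, smul_mulVec, sub_eq_zero] using hker i
  let V : Matrix κ κ 𝔽 := (of v)ᵀ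
  have hV : IsUnit V := by
    refine linearIndependent_cols_iff_isUnit.1 ?_
    refine Module.End.eigenvectors_linearIndependent' (toLin' (M₁⁻¹ * M₂)) μ hμ v fun i => ?_
    refine ⟨Module.End.mem_eigenspace_iff.2 ?_, hv i⟩
    rw [toLin'_apply, ← mulVec_mulVec, heig, mulVec_smul, mulVec_mulVec,
      nonsing_inv_mul _ hM₁, one_mulVec]
  have hVV : V * V⁻¹ = 1 := mul_nonsing_inv _ ((isUnit_iff_isUnit_det _).1 hV)
  have hMV : M₂ * V = M₁ * V * diagonal μ := by
    ext a i
    rw [mul_diagonal]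
    have := congrFun (heig i) a
    simpa [V, mul_apply, mulVec, dotProduct, mul_comm] using this
  refine ⟨M₁ * V, V⁻¹, ?_, ?_⟩
  · rw [Matrix.mul_assoc, hVV, Matrix.mul_one]
  · rw [← hMV, Matrix.mul_assoc, hVV, Matrix.mul_one]

/-- Any two square matrices become simultaneously diagonalizable (as a pencil) after changing
their diagonals. -/
theorem exists_add_diagonal_eq_mul_diagonal_mul {κ : Type*} [RCLike 𝔽] [Fintype κ]
    [DecidableEq κ] (N₁ N₂ : Matrix κ κ 𝔽) :
    ∃ (x y u v : κ → 𝔽) (R S : Matrix κ κ 𝔽),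
      N₁ + diagonal x = R * diagonal u * S ∧ N₂ + diagonal y = R * diagonal v * S := by
  obtain ⟨l, hl⟩ : ∃ l : κ → 𝔽, Function.Injective l :=
    ⟨fun i => (Fintype.equivFin κ i : ℕ), fun i j h =>
      (Fintype.equivFin κ).injective (Fin.ext (Nat.cast_injective h))⟩
  choose ψ hψ hψdet using exists_tendsto_det_pencil_eq_zero N₁ N₂ hl
  have hinj : ∀ᶠ s in 𝓝 (0 : 𝔽), Function.Injective fun i => ψ i s := by
    have : ∀ᶠ s in 𝓝 (0 : 𝔽), ∀ i j, i ≠ j → ψ i s ≠ ψ j s := by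
      refine eventually_all.2 fun i => eventually_all.2 fun j => ?_
      by_cases hij : i = j
      · simp [hij]
      · filter_upwards [((hψ i).sub (hψ j)).eventually_ne (sub_ne_zero.2 (hl.ne hij))] with s hs _
          using sub_ne_zero.1 hs
    filter_upwards [this] with s hs i j h
    by_contra hij
    exact hs i j hij h
  have hunit : ∀ᶠ s in 𝓝 (0 : 𝔽), (1 + s • N₁).det ≠ 0 := by
    have hcont : Continuous fun s : 𝔽 => (1 + s • N₁).det := by fun_prop
    exact hcont.continuousAt.eventually_ne (by simp)
  have hev : ∀ᶠ s in 𝓝[≠] (0 : 𝔽), s ≠ 0 ∧ (1 + s • N₁).det ≠ 0 ∧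
      (Function.Injective fun i => ψ i s) ∧
      ∀ i, (diagonal l + s • N₂ - ψ i s • (1 + s • N₁)).det = 0 := by
    filter_upwards [self_mem_nhdsWithin, nhdsWithin_le_nhds hunit, nhdsWithin_le_nhds hinj,
      nhdsWithin_le_nhds (eventually_all.2 hψdet)] with s h0 h1 h2 h3
    exact ⟨h0, h1, h2, h3⟩
  obtain ⟨s, hs, hdet, hμ, hzero⟩ := hev.exists
  obtain ⟨R, S, h₁, h₂⟩ := exists_eq_mul_diagonal_mul_of_det_eq_zero (isUnit_iff_ne_zero.2 hdet)
    hμ hzero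
  refine ⟨fun _ => s⁻¹, s⁻¹ • l, fun _ => 1, fun i => ψ i s, s⁻¹ • R, S, ?_, ?_⟩
  · rw [diagonal_one, Matrix.mul_one, Matrix.smul_mul, ← h₁, smul_add, smul_smul,
      inv_mul_cancel₀ hs, one_smul, smul_one_eq_diagonal, add_comm]
  · rw [Matrix.smul_mul, Matrix.smul_mul, ← h₂, smul_add, smul_smul,
      inv_mul_cancel₀ hs, one_smul, diagonal_smul, add_comm]

/-- The matrix of the coordinate projection along an embedding of index types. -/
def coordProj (𝔽 : Type*) [Zero 𝔽] [One 𝔽] {ι κ : Type*} [DecidableEq κ] (e : ι ↪ κ) :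
    Matrix ι κ 𝔽 :=
  submatrix 1 e id

section coordProj

variable [CommRing 𝔽] {ι κ : Type*} [DecidableEq κ] (e : ι ↪ κ)

theorem coordProj_apply (i : ι) (j : κ) : coordProj 𝔽 e i j = if e i = j then 1 else 0 := by
  simp [coordProj, one_apply]

theorem coordProj_mul_transpose [Fintype κ] [DecidableEq ι] :
    coordProj 𝔽 e * (coordProj 𝔽 e)ᵀ = 1 := by
  ext i j
  simp [mul_apply, coordProj_apply, one_apply, e.injective.eq_iff, eq_comm]

theorem coordProj_mul_diagonal [Fintype ι] [DecidableEq ι] [Fintype κ] (x : κ → 𝔽) :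
    coordProj 𝔽 e * diagonal x = diagonal (x ∘ e) * coordProj 𝔽 e := by
  ext i j
  rw [mul_diagonal, diagonal_mul, coordProj_apply]
  split_ifs with h
  · simp [← h]
  · simp

theorem transpose_coordProj_mul_diagonal_mul [Fintype ι] [DecidableEq ι] {x : κ → 𝔽}
    (hx : ∀ j, j ∉ Set.range e → x j = 0) :
    (coordProj 𝔽 e)ᵀ * diagonal (x ∘ e) * coordProj 𝔽 e = diagonal x := by
  ext j k
  rw [mul_apply]
  simp only [mul_diagonal, transpose_apply, coordProj_apply]
  by_cases hj : j ∈ Set.range e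
  · obtain ⟨i, rfl⟩ := hj
    rw [Finset.sum_eq_single i (fun i' _ h => by simp [e.injective.ne h]) (by simp)]
    simp [diagonal_apply]
  · have hne (i) : e i ≠ j := fun h => hj ⟨i, h⟩
    simp [hne, diagonal_apply, hx j hj]

/-- A change of coordinates on the image of a coordinate projection lifts to its source. -/
theorem exists_isUnit_det_coordProj_mul [Fintype ι] [DecidableEq ι] [Fintype κ]
    {P : Matrix ι ι 𝔽} (hP : IsUnit P.det) :
    ∃ Q : Matrix κ κ 𝔽, IsUnit Q.det ∧ coordProj 𝔽 e * Q = P * coordProj 𝔽 e := by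
  set J := coordProj 𝔽 e
  have hJ : J * Jᵀ = 1 := coordProj_mul_transpose e
  have hJ' (B : Matrix ι κ 𝔽) : J * (Jᵀ * B) = B := by
    rw [← Matrix.mul_assoc, hJ, Matrix.one_mul]
  have hP' (B : Matrix ι κ 𝔽) : P * (P⁻¹ * B) = B := by
    rw [← Matrix.mul_assoc, mul_nonsing_inv _ hP, Matrix.one_mul]
  refine ⟨1 + Jᵀ * (P - 1) * J, ?_, ?_⟩
  · refine isUnit_det_of_right_inverse (B := 1 + Jᵀ * (P⁻¹ - 1) * J) ?_
    simp only [Matrix.mul_add, Matrix.add_mul, Matrix.mul_sub, Matrix.sub_mul, Matrix.mul_one,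
      Matrix.one_mul, Matrix.mul_assoc, hJ', hP']
    abel
  · simp only [Matrix.mul_add, Matrix.mul_one, Matrix.mul_assoc, hJ']
    rw [Matrix.sub_mul, Matrix.one_mul]
    abel

end coordProj

/-- A rectangular matrix with at least as many columns as rows is diagonal in suitable bases. -/
theorem exists_eq_mul_diagonal_mul_coordProj_mul [Field 𝔽] {n m : ℕ} (hnm : n ≤ m)
    (A : Matrix (Fin n) (Fin m) 𝔽) :
    ∃ (P : Matrix (Fin n) (Fin n) 𝔽) (Q : Matrix (Fin m) (Fin m) 𝔽) (e : Fin n ↪ Fin m)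
      (d : Fin n → 𝔽), IsUnit P.det ∧ IsUnit Q.det ∧
        A = P * diagonal d * coordProj 𝔽 e * Q := by
  classical
  let J₀ := coordProj 𝔽 (Fin.castLEEmb hnm)
  obtain ⟨L, L', x, hx⟩ :=
    Pivot.exists_list_transvec_mul_diagonal_mul_list_transvec (J₀ᵀ * A)
  set T := (L.map TransvectionStruct.toMatrix).prod
  set T' := (L'.map TransvectionStruct.toMatrix).prod
  have hT : IsUnit T.det := by simp [T]
  have hT' : IsUnit T'.det := by simp [T']
  have hcard : (Finset.univ.filter fun i => x i ≠ 0).card ≤ n := by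
    have hrank : (J₀ᵀ * A).rank ≤ n := (rank_mul_le_right _ _).trans (rank_le_height A)
    rw [hx, rank_mul_eq_left_of_isUnit_det _ _ hT', rank_mul_eq_right_of_isUnit_det _ _ hT,
      rank_diagonal, Fintype.card_subtype] at hrank
    exact hrank
  obtain ⟨s, hs, hsn⟩ := Finset.exists_superset_card_eq hcard (by simpa using hnm)
  let e : Fin n ↪ Fin m := (s.orderEmbOfFin hsn).toEmbedding
  have hsupp (j) (hj : j ∉ Set.range e) : x j = 0 := by
    by_contra h
    have : j ∈ Set.range (s.orderEmbOfFin hsn) := by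
      rw [Finset.range_orderEmbOfFin]
      exact hs (by simpa using h)
    exact hj this
  obtain ⟨M, M', d, hd⟩ := Pivot.exists_list_transvec_mul_diagonal_mul_list_transvec
    (J₀ * T * (coordProj 𝔽 e)ᵀ * diagonal (x ∘ e))
  obtain ⟨Q, hQ, hJQ⟩ := exists_isUnit_det_coordProj_mul e
    (P := (M'.map TransvectionStruct.toMatrix).prod) (by simp)
  refine ⟨(M.map TransvectionStruct.toMatrix).prod, Q * T', e, d, by simp, ?_, ?_⟩
  · rw [det_mul]
    exact hQ.mul hT'
  · calc A = J₀ * (J₀ᵀ * A) := by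
          rw [← Matrix.mul_assoc, coordProj_mul_transpose, Matrix.one_mul]
      _ = J₀ * T * (coordProj 𝔽 e)ᵀ * diagonal (x ∘ e) * (coordProj 𝔽 e * T') := by
          rw [hx, ← transpose_coordProj_mul_diagonal_mul e hsupp]
          simp only [Matrix.mul_assoc]
      _ = _ := by
          rw [hd, Matrix.mul_assoc _ _ (coordProj 𝔽 e * T'), ← Matrix.mul_assoc _ (coordProj 𝔽 e) T', ← hJQ]
          simp only [Matrix.mul_assoc]

/-- The span of the rank-one matrices formed from the columns of `L` and the rows of `R`. -/
def rankOneSpan {α β κ : Type*} [Field 𝔽] (L : Matrix α κ 𝔽) (R : Matrix κ β 𝔽) :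
    Submodule 𝔽 (Matrix α β 𝔽) :=
  Submodule.span 𝔽 (Set.range fun i => vecMulVec (L.col i) (R.row i))

theorem mul_diagonal_mul_mem_rankOneSpan {α β κ : Type*} [Field 𝔽] [Fintype κ] [DecidableEq κ]
    (L : Matrix α κ 𝔽) (u : κ → 𝔽) (R : Matrix κ β 𝔽) :
    L * diagonal u * R ∈ rankOneSpan L R := by
  rw [mul_diagonal_mul_eq_sum]
  exact Submodule.sum_mem _ fun i _ =>
    Submodule.smul_mem _ _ (Submodule.subset_span (Set.mem_range_self i))

/-- Modulo the rank-one matrices attached to a diagonalization with `n` terms, any two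
`n × m` matrices are combinations of `m` common rank-one matrices. -/
theorem exists_mem_rankOneSpan_sup [RCLike 𝔽] {ι κ : Type*} [Fintype ι] [DecidableEq ι]
    [Fintype κ] [DecidableEq κ] {P : Matrix ι ι 𝔽} {Q : Matrix κ κ 𝔽} (hP : IsUnit P.det)
    (hQ : IsUnit Q.det) (e : ι ↪ κ) (A₁ A₂ : Matrix ι κ 𝔽) :
    ∃ (R : Matrix ι κ 𝔽) (S : Matrix κ κ 𝔽),
      A₁ ∈ rankOneSpan P (coordProj 𝔽 e * Q) ⊔ rankOneSpan R S ∧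
      A₂ ∈ rankOneSpan P (coordProj 𝔽 e * Q) ⊔ rankOneSpan R S := by
  let J := coordProj 𝔽 e
  obtain ⟨x, y, u, v, R, S, h₁, h₂⟩ := exists_add_diagonal_eq_mul_diagonal_mul
    (Jᵀ * (P⁻¹ * A₁ * Q⁻¹)) (Jᵀ * (P⁻¹ * A₂ * Q⁻¹))
  have key {A : Matrix ι κ 𝔽} {x u : κ → 𝔽}
      (h : Jᵀ * (P⁻¹ * A * Q⁻¹) + diagonal x = R * diagonal u * S) :
      A ∈ rankOneSpan P (J * Q) ⊔ rankOneSpan (P * J * R) (S * Q) := by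
    have hA : A = P * (J * (Jᵀ * (P⁻¹ * A * Q⁻¹))) * Q := by
      rw [← Matrix.mul_assoc J, coordProj_mul_transpose, Matrix.one_mul, Matrix.mul_assoc _ A,
        mul_nonsing_inv_cancel_left _ _ hP, nonsing_inv_mul_cancel_right _ _ hQ]
    have hsplit : A = P * diagonal (-(x ∘ e)) * (J * Q) +
        P * J * R * diagonal u * (S * Q) := by
      rw [hA, eq_sub_of_add_eq h, Matrix.mul_sub, coordProj_mul_diagonal, Matrix.mul_sub,
        Matrix.sub_mul, sub_eq_neg_add]
      congr 1
      · rw [show diagonal (-(x ∘ e)) = -diagonal (x ∘ e) from (diagonal_neg _).symm]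
        simp only [Matrix.mul_assoc, Matrix.neg_mul, Matrix.mul_neg, J]
      · simp only [Matrix.mul_assoc]
    rw [hsplit]
    exact Submodule.add_mem_sup (mul_diagonal_mul_mem_rankOneSpan _ _ _)
      (mul_diagonal_mul_mem_rankOneSpan _ _ _)
  exact ⟨_, _, key h₁, key h₂⟩

end Matrix

theorem tensorRank_le_card {𝔽 : Type*} [Field 𝔽] {α β γ ι : Type*} [Fintype α] [Fintype β]
    [Fintype γ] [Fintype ι] {A : γ → Matrix α β 𝔽} (a : ι → α → 𝔽) (b : ι → β → 𝔽)
    (h : ∀ k, A k ∈ Submodule.span 𝔽 (Set.range fun i => Matrix.vecMulVec (a i) (b i))) :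
    tensorRank 𝔽 A ≤ Fintype.card ι := by
  choose c hc using fun k => (Submodule.mem_span_range_iff_exists_fun 𝔽).1 (h k)
  let σ := (Fintype.equivFin ι).symm
  refine Nat.sInf_le ⟨a ∘ σ, b ∘ σ, fun i k => c k (σ i), fun k => ?_⟩
  rw [← hc k]
  exact (σ.sum_comp fun i => c k i • Matrix.vecMulVec (a i) (b i)).symm

theorem tensorRank_le {𝔽 : Type*} [RCLike 𝔽] {n m q : ℕ} (hnm : n ≤ m)
    (A : Fin (2 * q + 2) → Matrix (Fin n) (Fin m) 𝔽) :
    tensorRank 𝔽 A ≤ 2 * n + m * q := by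
  obtain ⟨P, Q, e, d, hP, hQ, hA⟩ :=
    Matrix.exists_eq_mul_diagonal_mul_coordProj_mul hnm (A ⟨2 * q + 1, by omega⟩)
  choose R S hodd heven using fun j : Fin q => Matrix.exists_mem_rankOneSpan_sup hP hQ e
    (A ⟨2 * j + 1, by omega⟩) (A ⟨2 * j, by omega⟩)
  let B := A ⟨2 * q, by omega⟩
  let a : (Fin n ⊕ Fin n) ⊕ (Fin q × Fin m) → Fin n → 𝔽 :=
    Sum.elim (Sum.elim (Matrix.col 1) P.col) fun jk => (R jk.1).col jk.2
  let b : (Fin n ⊕ Fin n) ⊕ (Fin q × Fin m) → Fin m → 𝔽 :=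
    Sum.elim (Sum.elim B.row (Matrix.coordProj 𝔽 e * Q).row) fun jk => (S jk.1).row jk.2
  let W := Submodule.span 𝔽 (Set.range fun i => Matrix.vecMulVec (a i) (b i))
  have hWB : Matrix.rankOneSpan 1 B ≤ W :=
    Submodule.span_mono (Set.range_subset_iff.2 fun i => ⟨Sum.inl (Sum.inl i), rfl⟩)
  have hWP : Matrix.rankOneSpan P (Matrix.coordProj 𝔽 e * Q) ≤ W :=
    Submodule.span_mono (Set.range_subset_iff.2 fun i => ⟨Sum.inl (Sum.inr i), rfl⟩)
  have hWR (j) : Matrix.rankOneSpan (R j) (S j) ≤ W :=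
    Submodule.span_mono (Set.range_subset_iff.2 fun k => ⟨Sum.inr (j, k), rfl⟩)
  have hlastEven : B ∈ W := hWB <| by
    have := Matrix.mul_diagonal_mul_mem_rankOneSpan (1 : Matrix (Fin n) (Fin n) 𝔽)
      (fun _ => 1) B
    rwa [Matrix.diagonal_one, Matrix.mul_one, Matrix.one_mul] at this
  have hlastOdd : A ⟨2 * q + 1, by omega⟩ ∈ W := hWP <| by
    rw [hA, Matrix.mul_assoc _ _ Q]
    exact Matrix.mul_diagonal_mul_mem_rankOneSpan _ _ _
  have hmem (k) : A k ∈ W := by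
    obtain ⟨k, hk⟩ := k
    obtain ⟨j, rfl | rfl⟩ := Nat.even_or_odd' k
    · obtain rfl | hj := eq_or_ne j q
      · exact hlastEven
      · exact sup_le hWP (hWR ⟨j, by omega⟩) (heven ⟨j, by omega⟩)
    · obtain rfl | hj := eq_or_ne j q
      · exact hlastOdd
      · exact sup_le hWP (hWR ⟨j, by omega⟩) (hodd ⟨j, by omega⟩)
  refine (tensorRank_le_card a b hmem).trans_eq ?_
  simp only [Fintype.card_sum, Fintype.card_prod, Fintype.card_fin]
  ring

/-- If `𝔽` is `ℝ` or `ℂ`, `n ≤ m` and `p` is even, then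
`maxRank 𝔽 n m p ≤ 2 * n + m * (p - 2) / 2`. -/
theorem stmt5 {𝔽 : Type*} [RCLike 𝔽] {n m p : ℕ}
    (hn : 0 < n) (hp : 0 < p) (hnm : n ≤ m) (heven : Even p) :
    maxRank 𝔽 n m p ≤ 2 * n + m * (p - 2) / 2 := by
  obtain ⟨q, rfl⟩ : ∃ q, p = 2 * q + 2 := by
    obtain ⟨r, rfl⟩ := heven
    exact ⟨r - 1, by omega⟩
  have hq : m * (2 * q + 2 - 2) / 2 = m * q := by
    rw [Nat.add_sub_cancel, mul_left_comm, Nat.mul_div_cancel_left _ two_pos]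
  rw [hq]
  refine csSup_le' ?_
  rintro _ ⟨A, rfl⟩
  exact tensorRank_le hnm A
end

section
/- Let 𝔽 be ℝ or ℂ and let k, m, n be positive integers with k ≤ m ≤ n. Then max.rank_𝔽(m, n, mn−k) = mn − k² + max.rank_𝔽(k, k, k²−k). -/
open Module Submodule in
/-- A subspace extends to any larger dimension not exceeding that of the ambient space. -/
theorem Submodule.exists_le_finrank_eq {K E : Type*} [Field K] [AddCommGroup E] [Module K E]
    [FiniteDimensional K E] (V : Submodule K E) {p : ℕ} (hV : finrank K V ≤ p)
    (hp : p ≤ finrank K E) : ∃ W : Submodule K E, V ≤ W ∧ finrank K W = p := by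
  induction p, hV using Nat.le_induction with
  | base => exact ⟨V, le_rfl, rfl⟩
  | succ p _ ih =>
    obtain ⟨W, hVW, hW⟩ := ih (by omega)
    obtain ⟨v, hv⟩ := W.exists_of_finrank_lt (by omega)
    have hvW : v ∉ W := fun h => hv 1 one_ne_zero (by simpa using h)
    have hv0 : v ≠ 0 := fun h => hvW (h ▸ W.zero_mem)
    refine ⟨W ⊔ span K {v}, hVW.trans le_sup_left, ?_⟩
    have h := finrank_sup_add_finrank_inf_eq W (span K {v})
    rw [(disjoint_span_singleton_of_notMem hvW).eq_bot, finrank_bot,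
      finrank_span_singleton hv0] at h
    omega

section TensorRank

open Module Submodule Matrix

variable {𝔽 : Type*} [Field 𝔽]

/-- The matrices of rank at most one. -/
def dyads (𝔽 : Type*) [Field 𝔽] (α β : Type*) : Set (Matrix α β 𝔽) :=
  {X | ∃ a b, X = vecMulVec a b}

/-- `V` lies in a subspace of dimension at most `r` that is spanned by dyads. -/
def DyadicallyCovered {α β : Type*} (V : Submodule 𝔽 (Matrix α β 𝔽)) (r : ℕ) : Prop :=
  ∃ S ⊆ dyads 𝔽 α β, V ≤ span 𝔽 S ∧ finrank 𝔽 (span 𝔽 S) ≤ r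

theorem DyadicallyCovered.mono {α β : Type*} {V W : Submodule 𝔽 (Matrix α β 𝔽)} {r : ℕ}
    (h : DyadicallyCovered W r) (hVW : V ≤ W) : DyadicallyCovered V r := by
  obtain ⟨S, hS, hW, hr⟩ := h
  exact ⟨S, hS, hVW.trans hW, hr⟩

theorem span_dyads (α β : Type*) [Fintype α] [Fintype β] : span 𝔽 (dyads 𝔽 α β) = ⊤ := by
  classical
  refine eq_top_iff.2 fun X _ => ?_
  rw [matrix_eq_sum_single X]
  refine sum_mem fun i _ => sum_mem fun j _ =>
    subset_span ⟨X i j • Pi.single i 1, Pi.single j 1, ?_⟩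
  rw [smul_vecMulVec, ← single_eq_single_vecMulVec_single]
  simp

theorem tensorRank_le_iff {α β γ : Type*} [Fintype α] [Fintype β] [Fintype γ]
    {A : γ → Matrix α β 𝔽} {r : ℕ} :
    tensorRank 𝔽 A ≤ r ↔ DyadicallyCovered (span 𝔽 (Set.range A)) r := by
  have key : ∀ s, DyadicallyCovered (span 𝔽 (Set.range A)) s → tensorRank 𝔽 A ≤ s ∧
      tensorRank 𝔽 A ∈ {r : ℕ | ∃ (a : Fin r → α → 𝔽) (b : Fin r → β → 𝔽) (c : Fin r → γ → 𝔽),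
        ∀ k, A k = ∑ i, c i k • vecMulVec (a i) (b i)} := by
    rintro s ⟨S, hS, hA, hs⟩
    obtain ⟨f, hfS, hf, -⟩ := exists_fun_fin_finrank_span_eq 𝔽 S
    choose a b hab using fun i => hS (hfS i)
    have hc : ∀ k, ∃ c : Fin (finrank 𝔽 (span 𝔽 S)) → 𝔽, ∑ i, c i • f i = A k := fun k =>
      (mem_span_range_iff_exists_fun 𝔽).1 (hf.symm ▸ hA (subset_span ⟨k, rfl⟩))
    choose c hc using hc
    have hmem : finrank 𝔽 (span 𝔽 S) ∈ {r : ℕ | ∃ (a : Fin r → α → 𝔽) (b : Fin r → β → 𝔽)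
        (c : Fin r → γ → 𝔽), ∀ k, A k = ∑ i, c i k • vecMulVec (a i) (b i)} :=
      ⟨a, b, fun i k => c k i, fun k => by simp only [← hab, hc]⟩
    exact ⟨(Nat.sInf_le hmem).trans hs, Nat.sInf_mem ⟨_, hmem⟩⟩
  refine ⟨fun h => ?_, fun h => (key r h).1⟩
  obtain ⟨a, b, c, hA⟩ := (key _ ⟨_, subset_rfl, by simp [span_dyads], le_rfl⟩).2
  refine ⟨Set.range fun i => vecMulVec (a i) (b i), ?_, ?_, ?_⟩
  · rintro _ ⟨i, rfl⟩
    exact ⟨_, _, rfl⟩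
  · rw [span_le]
    rintro _ ⟨k, rfl⟩
    rw [hA]
    exact sum_mem fun i _ => smul_mem _ _ (subset_span ⟨i, rfl⟩)
  · exact (finrank_range_le_card _).trans (by simpa using h)

theorem maxRank_le_iff {m n p r : ℕ} (hp : p ≤ m * n) :
    maxRank 𝔽 m n p ≤ r ↔ ∀ V : Submodule 𝔽 (Matrix (Fin m) (Fin n) 𝔽),
      finrank 𝔽 V = p → DyadicallyCovered V r := by
  have hbdd : BddAbove {r | ∃ A : Fin p → Matrix (Fin m) (Fin n) 𝔽, tensorRank 𝔽 A = r} := by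
    refine ⟨finrank 𝔽 (span 𝔽 (dyads 𝔽 (Fin m) (Fin n))), ?_⟩
    rintro _ ⟨A, rfl⟩
    exact tensorRank_le_iff.2 ⟨_, subset_rfl, by simp [span_dyads], le_rfl⟩
  constructor
  · rintro h V rfl
    have hA := tensorRank_le_iff.1
      ((le_csSup hbdd ⟨fun i => (finBasis 𝔽 V i : Matrix _ _ 𝔽), rfl⟩).trans h)
    refine hA.mono ?_
    have := congrArg (Submodule.map V.subtype) (finBasis 𝔽 V).span_eq
    rw [map_span, ← Set.range_comp, Submodule.map_top, range_subtype] at this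
    exact this.ge
  · intro h
    refine csSup_le ⟨_, 0, rfl⟩ ?_
    rintro _ ⟨A, rfl⟩
    obtain ⟨W, hW, hWp⟩ := (span 𝔽 (Set.range A)).exists_le_finrank_eq (p := p)
      ((finrank_range_le_card A).trans (by simp)) (by simpa [finrank_matrix] using hp)
    exact tensorRank_le_iff.2 ((h W hWp).mono hW)

theorem maxRank_transpose_le {m n p : ℕ} (hp : p ≤ m * n) :
    maxRank 𝔽 m n p ≤ maxRank 𝔽 n m p := by
  rw [maxRank_le_iff hp]
  intro V hV
  let e := transposeLinearEquiv (Fin m) (Fin n) 𝔽 𝔽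
  obtain ⟨S, hS, hVS, hr⟩ := (maxRank_le_iff (p := p) (by rwa [mul_comm])).1 le_rfl
    (V.map e.toLinearMap) ((LinearEquiv.finrank_map_eq e V).trans hV)
  refine ⟨e.symm '' S, ?_, ?_, ?_⟩
  · rintro _ ⟨X, hX, rfl⟩
    obtain ⟨a, b, rfl⟩ := hS hX
    exact ⟨b, a, transpose_vecMulVec a b⟩
  · rw [← LinearEquiv.coe_coe, ← map_span]
    exact fun X hX => ⟨e X, hVS ⟨X, hX, rfl⟩, e.symm_apply_apply X⟩
  · rw [← LinearEquiv.coe_coe, ← map_span]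
    exact (LinearEquiv.finrank_map_eq e.symm _).trans_le hr

/-- A subspace of codimension `k < n` of the `m × n` matrices contains in every row a nonzero
matrix supported on that row, and over an infinite field some functional is normalised on all
of them. -/
theorem exists_functional_row_mem [Infinite 𝔽] {m n k : ℕ} (hkn : k < n)
    (V : Submodule 𝔽 (Matrix (Fin m) (Fin n) 𝔽)) (hV : m * n ≤ finrank 𝔽 V + k) :
    ∃ (h : Dual 𝔽 (Fin n → 𝔽)) (w : Fin m → Fin n → 𝔽), (∀ i, h (w i) = 1) ∧
      ∀ i, vecMulVec (Pi.single i 1) (w i) ∈ V := by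
  have hw : ∀ i : Fin m, ∃ w : Fin n → 𝔽, w ≠ 0 ∧ vecMulVec (Pi.single i 1) w ∈ V := by
    intro i
    let f : (Fin n → 𝔽) →ₗ[𝔽] Matrix (Fin m) (Fin n) 𝔽 :=
      { toFun := vecMulVec (Pi.single i 1)
        map_add' := vecMulVec_add _
        map_smul' := fun c w => vecMulVec_smul c _ w }
    have hq := V.finrank_quotient_add_finrank
    rw [finrank_matrix, finrank_self] at hq
    simp only [Fintype.card_fin, mul_one] at hq
    obtain ⟨w, hw, hw0⟩ := exists_mem_ne_zero_of_ne_bot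
      ((V.mkQ ∘ₗ f).ker_ne_bot_of_finrank_lt (by rw [finrank_fin_fun]; omega))
    exact ⟨w, hw0, (Quotient.mk_eq_zero V).1 hw⟩
  choose w hw0 hw using hw
  obtain ⟨h, hh⟩ := exists_dual_forall_apply_ne_zero (K := 𝔽) w hw0
  refine ⟨h, fun i => (h (w i))⁻¹ • w i, fun i => by simp [hh i], fun i => ?_⟩
  rw [vecMulVec_smul]
  exact V.smul_mem _ (hw i)

theorem maxRank_succ_le [Infinite 𝔽] {m n k : ℕ} (hm : 0 < m) (hkn : k ≤ n) :
    maxRank 𝔽 m (n + 1) (m * (n + 1) - k) ≤ m + maxRank 𝔽 m n (m * n - k) := by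
  rw [maxRank_le_iff (Nat.sub_le _ _)]
  intro V hV
  obtain ⟨h, w, hw, hwV⟩ :=
    exists_functional_row_mem (n := n + 1) (Nat.lt_succ_of_le hkn) V (by omega)
  let i₀ : Fin m := ⟨0, hm⟩
  have hsurj : Function.Surjective h := LinearMap.surjective fun h0 => by simpa [h0] using hw i₀
  have hker : finrank 𝔽 h.ker = n := by
    have := h.finrank_range_add_finrank_ker
    rw [LinearMap.range_eq_top.2 hsurj, finrank_top, finrank_self, finrank_fin_fun] at this
    omega
  let e : (Fin n → 𝔽) ≃ₗ[𝔽] h.ker := LinearEquiv.ofFinrankEq _ _ (by rw [hker, finrank_fin_fun])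
  let N : Matrix (Fin n) (Fin (n + 1)) 𝔽 := (LinearMap.toMatrix' (h.ker.subtype ∘ₗ e.toLinearMap))ᵀ
  have hN : ∀ x, x ᵥ* N = e x := fun x => by
    simp [N, vecMul_transpose, LinearMap.toMatrix'_mulVec]
  let J : Matrix (Fin m) (Fin n) 𝔽 →ₗ[𝔽] Matrix (Fin m) (Fin (n + 1)) 𝔽 :=
    mulRightLinearMap (Fin m) 𝔽 N
  have hJ : ∀ X i, J X i = e (X i) := fun X i => hN (X i)
  let g : Matrix (Fin m) (Fin (n + 1)) 𝔽 →ₗ[𝔽] (Fin m → 𝔽) :=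
    LinearMap.pi fun i => h ∘ₗ LinearMap.proj i
  have hg : ∀ X i, g X i = h (X i) := fun X i => rfl
  let s : (Fin m → 𝔽) → Matrix (Fin m) (Fin (n + 1)) 𝔽 :=
    fun c => ∑ i, c i • vecMulVec (Pi.single i 1) (w i)
  have hs : ∀ c i, s c i = c i • w i := fun c i => by
    ext j
    simp [s, Matrix.sum_apply, vecMulVec_apply, Pi.single_apply]
  have hsV : ∀ c, s c ∈ V := fun c => sum_mem fun i _ => V.smul_mem _ (hwV i)
  have hgs : ∀ c, g (s c) = c := fun c => by
    ext i
    simp [hg, hs, hw]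
  have hcomap : finrank 𝔽 (V.comap J) ≤ m * n - k := by
    have hrank := (g.domRestrict V).finrank_range_add_finrank_ker
    rw [LinearMap.range_eq_top.2 fun c => ⟨⟨s c, hsV c⟩, hgs c⟩, finrank_top, finrank_fin_fun,
      hV] at hrank
    have hle : finrank 𝔽 (V.comap J) ≤ finrank 𝔽 (g.domRestrict V).ker := by
      refine LinearMap.finrank_le_finrank_of_injective
        (f := ((J.restrict (p := V.comap J) (q := V) fun _ hX => hX).codRestrict _ fun X => ?_)) ?_
      · ext i
        exact (congrArg h (hJ X i)).trans (e (X.1 i)).2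
      · intro X Y hXY
        have hXY : J X.1 = J Y.1 := congrArg (fun Z => Z.1.1) hXY
        refine Subtype.ext (funext fun i => e.injective (Subtype.ext ?_))
        rw [← hJ, hXY, hJ]
    rw [Nat.mul_succ] at hrank
    omega
  obtain ⟨W, hVW, hW⟩ := (V.comap J).exists_le_finrank_eq hcomap
    (by simp [finrank_matrix])
  obtain ⟨S, hS, hWS, hr⟩ := (maxRank_le_iff (Nat.sub_le _ _)).1 le_rfl W hW
  refine ⟨Set.range (fun i => vecMulVec (Pi.single i 1) (w i)) ∪ J '' S, ?_, ?_, ?_⟩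
  · rintro _ (⟨i, rfl⟩ | ⟨X, hX, rfl⟩)
    · exact ⟨_, _, rfl⟩
    · obtain ⟨a, b, rfl⟩ := hS hX
      exact ⟨a, b ᵥ* N, vecMulVec_mul a b N⟩
  · intro X hX
    rw [span_union, ← map_span]
    have hker : ∀ i, (X - s (g X)) i ∈ h.ker := fun i => by
      have : (X - s (g X)) i = X i - s (g X) i := rfl
      simp [this, hs, hg, hw]
    let Y : Matrix (Fin m) (Fin n) 𝔽 := Matrix.of fun i => e.symm ⟨_, hker i⟩
    have hY : J Y = X - s (g X) := funext fun i =>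
      (hJ Y i).trans (congrArg Subtype.val (e.apply_symm_apply ⟨_, hker i⟩))
    rw [← add_sub_cancel (s (g X)) X, ← hY]
    refine add_mem_sup (sum_mem fun i _ => smul_mem _ _ (subset_span ⟨i, rfl⟩))
      (mem_map_of_mem (hWS (hVW ?_)))
    rw [mem_comap, hY]
    exact V.sub_mem hX (hsV _)
  · rw [span_union, ← map_span]
    refine (finrank_add_le_finrank_add_finrank _ _).trans (add_le_add ?_ ?_)
    · exact (finrank_range_le_card _).trans (by simp)
    · exact (finrank_map_le J _).trans hr

theorem maxRank_add_le [Infinite 𝔽] {m k : ℕ} (hm : 0 < m) (d : ℕ) :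
    maxRank 𝔽 m (k + d) (m * (k + d) - k) ≤ m * d + maxRank 𝔽 m k (m * k - k) := by
  induction d with
  | zero => simp
  | succ d ih =>
    have := maxRank_succ_le (𝔽 := 𝔽) hm (Nat.le_add_right k d)
    rw [← add_assoc, Nat.mul_succ m d]
    omega

theorem le_maxRank {k m n : ℕ} (hkm : k ≤ m) (hkn : k ≤ n) :
    m * n - k ^ 2 + maxRank 𝔽 k k (k ^ 2 - k) ≤ maxRank 𝔽 m n (m * n - k) := by
  set r := maxRank 𝔽 m n (m * n - k)
  have hkk : k ^ 2 ≤ m * n := by rw [sq]; exact Nat.mul_le_mul hkm hkn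
  have hksq : k ≤ k ^ 2 := Nat.le_self_pow two_ne_zero k
  let π : Matrix (Fin m) (Fin n) 𝔽 →ₗ[𝔽] Matrix (Fin k) (Fin k) 𝔽 :=
    { toFun := fun X => X.submatrix (Fin.castLE hkm) (Fin.castLE hkn)
      map_add' := fun _ _ => rfl
      map_smul' := fun _ _ => rfl }
  have hπ : Function.Surjective π := fun Y =>
    ⟨Matrix.of fun i j => if h : i.1 < k ∧ j.1 < k then Y ⟨i, h.1⟩ ⟨j, h.2⟩ else 0, by
      ext i j
      exact dif_pos ⟨i.2, j.2⟩⟩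
  have hker : finrank 𝔽 π.ker = m * n - k ^ 2 := by
    have := π.finrank_range_add_finrank_ker
    rw [LinearMap.range_eq_top.2 hπ, finrank_top, finrank_matrix, finrank_matrix] at this
    simp only [Fintype.card_fin, finrank_self, mul_one, ← sq] at this
    omega
  have key : ∀ V : Submodule 𝔽 (Matrix (Fin k) (Fin k) 𝔽), finrank 𝔽 V = k ^ 2 - k →
      m * n - k ^ 2 ≤ r ∧ DyadicallyCovered V (r - (m * n - k ^ 2)) := by
    intro V hV
    have hrank : ∀ W : Submodule 𝔽 (Matrix (Fin m) (Fin n) 𝔽), π.ker ≤ W →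
        finrank 𝔽 W = finrank 𝔽 (W.map π) + (m * n - k ^ 2) := fun W hW => by
      have := (π.domRestrict W).finrank_range_add_finrank_ker
      rw [LinearMap.range_domRestrict, LinearMap.ker_domRestrict,
        (comapSubtypeEquivOfLe hW).finrank_eq, hker] at this
      exact this.symm
    have hcomap := hrank (V.comap π) (LinearMap.ker_le_comap π)
    rw [map_comap_eq_of_surjective hπ, hV] at hcomap
    obtain ⟨S, hS, hVS, hr⟩ := (maxRank_le_iff (Nat.sub_le (m * n) k)).1 le_rfl (V.comap π)
      (hcomap.trans (by omega))
    have hspan := hrank (span 𝔽 S) ((LinearMap.ker_le_comap π).trans hVS)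
    refine ⟨by omega, π '' S, ?_, ?_, ?_⟩
    · rintro _ ⟨X, hX, rfl⟩
      obtain ⟨a, b, rfl⟩ := hS hX
      exact ⟨a ∘ Fin.castLE hkm, b ∘ Fin.castLE hkn, rfl⟩
    · rw [← map_span, ← map_comap_eq_of_surjective hπ V]
      exact map_mono hVS
    · rw [← map_span]
      omega
  obtain ⟨V, -, hV⟩ := (⊥ : Submodule 𝔽 (Matrix (Fin k) (Fin k) 𝔽)).exists_le_finrank_eq
    (p := k ^ 2 - k) (by simp) (by simp [finrank_matrix, ← sq])
  have hle : maxRank 𝔽 k k (k ^ 2 - k) ≤ r - (m * n - k ^ 2) :=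
    (maxRank_le_iff (by rw [← sq]; exact Nat.sub_le _ _)).2 fun V hV => (key V hV).2
  have := (key V hV).1
  omega

end TensorRank

/-- If `𝔽` is `ℝ` or `ℂ` and `k ≤ m ≤ n`, then
`maxRank 𝔽 m n (m * n - k) = m * n - k ^ 2 + maxRank 𝔽 k k (k ^ 2 - k)`. -/
theorem stmt8 {𝔽 : Type*} [RCLike 𝔽] {k m n : ℕ}
    (hk : 0 < k) (hkm : k ≤ m) (hmn : m ≤ n) :
    maxRank 𝔽 m n (m * n - k) = m * n - k ^ 2 + maxRank 𝔽 k k (k ^ 2 - k) := by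
  refine le_antisymm ?_ (le_maxRank hkm (hkm.trans hmn))
  obtain ⟨c, rfl⟩ := Nat.exists_eq_add_of_le hkm
  obtain ⟨d, rfl⟩ := Nat.exists_eq_add_of_le (hkm.trans hmn)
  have h₁ := maxRank_add_le (𝔽 := 𝔽) (k := k) (hk.trans_le hkm) d
  have h₂ := maxRank_transpose_le (𝔽 := 𝔽) (Nat.sub_le ((k + c) * k) k)
  have h₃ := maxRank_add_le (𝔽 := 𝔽) (k := k) hk c
  rw [mul_comm (k + c) k] at h₁ h₂
  rw [← sq] at h₃
  have hsize : (k + c) * (k + d) = k ^ 2 + (k * c + (k + c) * d) := by ring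
  omega
end
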